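/- Define σ, τ : [0,1] → [0,1] by σ(x) = min(x, 1−x), and τ(x) = x for x ∈ [0,1/2], τ(x) = 1−x for x ∈ [1/2,2/3], τ(x) = 3−4x for x ∈ [2/3,3/4], τ(x) = 0 for x ∈ [3/4,1]. Then σ and τ are both Z-retractions of [0,1] with range [0,1/2]; the Z-homeomorphism domains for σ are exactly [0,1/2] and [1/2,1], whereas the unique Z-homeomorphism domain for τ is [0,1/2]. Hence there are exactly two retractions of McN([0,1]) onto A_σ but exactly one retraction of McN([0,1]) onto A_τ, although A_σ and A_τ are isomorphic MV-algebras. -/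

import Mathlib

open Set MeasureTheory

/-- The unit cube `[0,1]^n` in `ℝ^n`. -/
def cubeSet (n : ℕ) : Set (Fin n → ℝ) := Set.Icc 0 1

/-- A point all of whose coordinates are rational. -/
def IsRationalPoint {n : ℕ} (v : Fin n → ℝ) : Prop := ∀ i, ∃ q : ℚ, v i = (q : ℝ)

/-- A rational polyhedron: a finite union of convex hulls of finite sets of rational points. -/
def IsRationalPolyhedron {n : ℕ} (P : Set (Fin n → ℝ)) : Prop :=
  ∃ S : Finset (Finset (Fin n → ℝ)),
    (∀ F ∈ S, ∀ v ∈ F, IsRationalPoint v) ∧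
    P = ⋃ F ∈ S, convexHull ℝ (F : Set (Fin n → ℝ))

/-- An affine map `x ↦ Mx + b` with integer matrix `M` and integer vector `b`. -/
def IsIntAffine {n m : ℕ} (g : (Fin n → ℝ) → (Fin m → ℝ)) : Prop :=
  ∃ (M : Fin m → Fin n → ℤ) (b : Fin m → ℤ),
    ∀ x i, g x i = (∑ j, (M i j : ℝ) * x j) + (b i : ℝ)

/-- A Z-map on `P`: continuous on `P`, with finitely many integer affine pieces. -/
def IsZMapOn {n m : ℕ} (P : Set (Fin n → ℝ)) (f : (Fin n → ℝ) → (Fin m → ℝ)) : Prop :=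
  ContinuousOn f P ∧
  ∃ (k : ℕ) (g : Fin k → (Fin n → ℝ) → (Fin m → ℝ)),
    (∀ i, IsIntAffine (g i)) ∧ ∀ x ∈ P, ∃ i, f x = g i x

/-- `f` restricted to `P` is a Z-homeomorphism of `P` onto `Q`. -/
def IsZHomeoOnto {n m : ℕ} (P : Set (Fin n → ℝ)) (Q : Set (Fin m → ℝ))
    (f : (Fin n → ℝ) → (Fin m → ℝ)) : Prop :=
  IsZMapOn P f ∧ f '' P = Q ∧ Set.InjOn f P ∧
  ∃ g : (Fin m → ℝ) → (Fin n → ℝ),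
    IsZMapOn Q g ∧ (∀ x ∈ P, g (f x) = x) ∧ (∀ y ∈ Q, f (g y) = y)

/-- A Z-retraction of the cube `[0,1]^n`. -/
def IsZRetraction {n : ℕ} (σ : (Fin n → ℝ) → (Fin n → ℝ)) : Prop :=
  IsZMapOn (cubeSet n) σ ∧ Set.MapsTo σ (cubeSet n) (cubeSet n) ∧
  ∀ x ∈ cubeSet n, σ (σ x) = σ x

/-- The range `R_σ = σ([0,1]^n)` of a Z-retraction. -/
def zRange {n : ℕ} (σ : (Fin n → ℝ) → (Fin n → ℝ)) : Set (Fin n → ℝ) := σ '' cubeSet n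

/-- A Z-homeomorphism domain for `σ`: a rational polyhedron `Q ⊆ [0,1]^n` such that
`σ` restricted to `Q` is a Z-homeomorphism of `Q` onto `R_σ`. -/
def IsZHomeoDomain {n : ℕ} (σ : (Fin n → ℝ) → (Fin n → ℝ)) (Q : Set (Fin n → ℝ)) : Prop :=
  IsRationalPolyhedron Q ∧ Q ⊆ cubeSet n ∧ IsZHomeoOnto Q (zRange σ) σ

/-- A (Kuratowski) closed domain: `D` equals the closure of its interior. -/
def IsClosedDomain {n : ℕ} (D : Set (Fin n → ℝ)) : Prop :=
  closure (interior D) = D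

/-- A scalar integer affine map. -/
def IsIntAffine1 {n : ℕ} (g : (Fin n → ℝ) → ℝ) : Prop :=
  ∃ (m : Fin n → ℤ) (b : ℤ), ∀ x, g x = (∑ j, (m j : ℝ) * x j) + (b : ℝ)

/-- A scalar Z-map on `P`. -/
def IsZMapOn1 {n : ℕ} (P : Set (Fin n → ℝ)) (f : (Fin n → ℝ) → ℝ) : Prop :=
  ContinuousOn f P ∧
  ∃ (k : ℕ) (g : Fin k → (Fin n → ℝ) → ℝ),
    (∀ i, IsIntAffine1 (g i)) ∧ ∀ x ∈ P, ∃ i, f x = g i x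

/-- The free MV-algebra `McN([0,1]^n)`, viewed as a set of functions on the cube. -/
def McN (n : ℕ) : Set (↥(cubeSet n) → ℝ) :=
  { f | (∀ x, f x ∈ Set.Icc (0:ℝ) 1) ∧
    ∃ g : (Fin n → ℝ) → ℝ, IsZMapOn1 (cubeSet n) g ∧ ∀ x : ↥(cubeSet n), f x = g x.1 }

/-- Pointwise MV-sum `f ⊕ g = min(f + g, 1)`. -/
def mvAdd {X : Type*} (f g : X → ℝ) : X → ℝ := fun x => min (f x + g x) 1

/-- Pointwise MV-negation `¬f = 1 - f`. -/
def mvNeg {X : Type*} (f : X → ℝ) : X → ℝ := fun x => 1 - f x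

/-- The retract `A_σ = {g ∘ σ : g ∈ McN([0,1]^n)}` associated with a Z-retraction `σ`. -/
def retAlg {n : ℕ} (σ : (Fin n → ℝ) → (Fin n → ℝ)) : Set (↥(cubeSet n) → ℝ) :=
  { f | ∃ g ∈ McN n, ∀ (x : ↥(cubeSet n)) (h : σ x.1 ∈ cubeSet n), f x = g ⟨σ x.1, h⟩ }

/-- `ε` is a retraction of `McN([0,1]^n)` onto `A`. -/
def IsMcNRetraction {n : ℕ} (ε : ↥(McN n) → ↥(McN n)) (A : Set (↥(cubeSet n) → ℝ)) : Prop :=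
  (∀ (f g : ↥(McN n)) (h : mvAdd f.1 g.1 ∈ McN n),
      (ε ⟨mvAdd f.1 g.1, h⟩).1 = mvAdd (ε f).1 (ε g).1) ∧
  (∀ (f : ↥(McN n)) (h : mvNeg f.1 ∈ McN n),
      (ε ⟨mvNeg f.1, h⟩).1 = mvNeg (ε f).1) ∧
  (∀ f, ε (ε f) = ε f) ∧
  Subtype.val '' Set.range ε = A

/-- An MV-isomorphism between two sets of `[0,1]`-valued functions. -/
def IsMVIsoFun {X Y : Type*} (A : Set (X → ℝ)) (B : Set (Y → ℝ)) (h : ↥A → ↥B) : Prop :=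
  Function.Bijective h ∧
  (∀ (f g : ↥A) (hm : mvAdd f.1 g.1 ∈ A),
      (h ⟨mvAdd f.1 g.1, hm⟩).1 = mvAdd (h f).1 (h g).1) ∧
  (∀ (f : ↥A) (hm : mvNeg f.1 ∈ A),
      (h ⟨mvNeg f.1, hm⟩).1 = mvNeg (h f).1)

/-- The segment `[a,b]` viewed as a subset of `ℝ¹`. -/
def seg (a b : ℝ) : Set (Fin 1 → ℝ) := {v | a ≤ v 0 ∧ v 0 ≤ b}

/-- `σ(x) = min(x, 1-x)`. -/
def sigma10 : (Fin 1 → ℝ) → (Fin 1 → ℝ) := fun v => ![min (v 0) (1 - v 0)]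

/-- `τ(x) = x` on `[0,1/2]`, `1-x` on `[1/2,2/3]`, `3-4x` on `[2/3,3/4]`, `0` on `[3/4,1]`. -/
noncomputable def tau10 : (Fin 1 → ℝ) → (Fin 1 → ℝ) := fun v =>
  ![if v 0 ≤ 1/2 then v 0 else if v 0 ≤ 2/3 then 1 - v 0
    else if v 0 ≤ 3/4 then 3 - 4 * v 0 else 0]

/-- `v` is given on `s` by finitely many integer affine formulas `t ↦ p.1 * t + p.2`. -/
def HasIntPieces {X : Type*} (s : Set X) (c v : X → ℝ) : Prop :=
  ∃ S : Finset (ℤ × ℤ), ∀ x ∈ s, ∃ p ∈ S, v x = (p.1 : ℝ) * c x + (p.2 : ℝ)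

lemma isZMapOn_iff {P : Set (Fin 1 → ℝ)} {f : (Fin 1 → ℝ) → (Fin 1 → ℝ)} :
    IsZMapOn P f ↔ ContinuousOn f P ∧ HasIntPieces P (fun x => x 0) (fun x => f x 0) := by
  classical
  refine and_congr_right fun _ => ⟨?_, ?_⟩
  · rintro ⟨k, g, hg, hf⟩
    choose M b hMb using hg
    refine ⟨Finset.univ.image fun i => (M i 0 0, b i 0), fun x hx => ?_⟩
    obtain ⟨i, hi⟩ := hf x hx
    refine ⟨_, Finset.mem_image_of_mem _ (Finset.mem_univ i), ?_⟩
    simp [hi, hMb]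
  · rintro ⟨S, hS⟩
    refine ⟨S.card, fun i x _ => ((S.equivFin.symm i).1.1 : ℝ) * x 0 + (S.equivFin.symm i).1.2,
      fun i => ⟨fun _ _ => (S.equivFin.symm i).1.1, fun _ => (S.equivFin.symm i).1.2,
        fun x j => by simp⟩, fun x hx => ?_⟩
    obtain ⟨p, hp, h⟩ := hS x hx
    refine ⟨S.equivFin ⟨p, hp⟩, ?_⟩
    ext j
    simpa [Subsingleton.elim j 0] using h

lemma isZMapOn1_iff {P : Set (Fin 1 → ℝ)} {f : (Fin 1 → ℝ) → ℝ} :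
    IsZMapOn1 P f ↔ ContinuousOn f P ∧ HasIntPieces P (fun x => x 0) f := by
  classical
  refine and_congr_right fun _ => ⟨?_, ?_⟩
  · rintro ⟨k, g, hg, hf⟩
    choose M b hMb using hg
    refine ⟨Finset.univ.image fun i => (M i 0, b i), fun x hx => ?_⟩
    obtain ⟨i, hi⟩ := hf x hx
    refine ⟨_, Finset.mem_image_of_mem _ (Finset.mem_univ i), ?_⟩
    simp [hi, hMb]
  · rintro ⟨S, hS⟩
    refine ⟨S.card, fun i x => ((S.equivFin.symm i).1.1 : ℝ) * x 0 + (S.equivFin.symm i).1.2,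
      fun i => ⟨fun _ => (S.equivFin.symm i).1.1, (S.equivFin.symm i).1.2,
        fun x => by simp⟩, fun x hx => ?_⟩
    obtain ⟨p, hp, h⟩ := hS x hx
    exact ⟨S.equivFin ⟨p, hp⟩, by simp [h]⟩

lemma mem_cubeSet_one {v : Fin 1 → ℝ} : v ∈ cubeSet 1 ↔ 0 ≤ v 0 ∧ v 0 ≤ 1 := by
  simp [cubeSet, Pi.le_def]

/-- The point of `[0,1]` (as a point of the one-dimensional cube) closest to `t`. -/
def clampPt (t : ℝ) : cubeSet 1 :=
  ⟨fun _ => max 0 (min t 1), mem_cubeSet_one.2 ⟨le_max_left _ _, by simp⟩⟩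

lemma clampPt_apply {t : ℝ} (h₀ : 0 ≤ t) (h₁ : t ≤ 1) (i : Fin 1) : (clampPt t).1 i = t := by
  simp [clampPt, h₀, h₁]

lemma continuous_clampPt : Continuous clampPt := by
  unfold clampPt
  fun_prop

lemma clampPt_coord (x : cubeSet 1) : clampPt (x.1 0) = x := by
  obtain ⟨h₀, h₁⟩ := mem_cubeSet_one.1 x.2
  ext i
  rw [clampPt_apply h₀ h₁, Subsingleton.elim i 0]

lemma clampPt_eq {v : Fin 1 → ℝ} (h : v ∈ cubeSet 1) {t : ℝ} (ht : v 0 = t) :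
    clampPt t = ⟨v, h⟩ := by
  rw [← ht]
  exact clampPt_coord ⟨v, h⟩

lemma mem_McN_one_iff {f : cubeSet 1 → ℝ} :
    f ∈ McN 1 ↔ (∀ x, f x ∈ Icc (0 : ℝ) 1) ∧ Continuous f ∧
      HasIntPieces univ (fun x : cubeSet 1 => x.1 0) f := by
  refine and_congr_right fun _ => ⟨?_, ?_⟩
  · rintro ⟨g, hg, hfg⟩
    obtain ⟨hc, S, hS⟩ := isZMapOn1_iff.1 hg
    obtain rfl : f = fun x => g x.1 := funext hfg
    exact ⟨continuousOn_iff_continuous_domRestrict.1 hc, S, fun x _ => hS x.1 x.2⟩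
  · rintro ⟨hc, S, hS⟩
    refine ⟨fun v => f (clampPt (v 0)), isZMapOn1_iff.2 ⟨?_, S, fun x hx => ?_⟩, fun x => ?_⟩
    · exact (hc.comp (continuous_clampPt.comp (continuous_apply 0))).continuousOn
    · have := hS ⟨x, hx⟩ (mem_univ _)
      simpa only [clampPt_eq hx rfl] using this
    · simp only [clampPt_coord]

namespace HasIntPieces

variable {X : Type*} {s : Set X} {c u v : X → ℝ}

lemma of_affine (p q : ℤ) (h : ∀ x ∈ s, v x = p * c x + q) : HasIntPieces s c v :=
  ⟨{(p, q)}, fun x hx => ⟨_, Finset.mem_singleton_self _, h x hx⟩⟩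

lemma of_or {w : X → ℝ} (hu : HasIntPieces s c u) (hv : HasIntPieces s c v)
    (h : ∀ x ∈ s, w x = u x ∨ w x = v x) : HasIntPieces s c w := by
  classical
  obtain ⟨S, hS⟩ := hu
  obtain ⟨T, hT⟩ := hv
  refine ⟨S ∪ T, fun x hx => ?_⟩
  rcases h x hx with h | h
  · obtain ⟨p, hp, e⟩ := hS x hx
    exact ⟨p, Finset.mem_union_left _ hp, h.trans e⟩
  · obtain ⟨p, hp, e⟩ := hT x hx
    exact ⟨p, Finset.mem_union_right _ hp, h.trans e⟩

lemma add (hu : HasIntPieces s c u) (hv : HasIntPieces s c v) :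
    HasIntPieces s c (fun x => u x + v x) := by
  classical
  obtain ⟨S, hS⟩ := hu
  obtain ⟨T, hT⟩ := hv
  refine ⟨(S ×ˢ T).image fun p => (p.1.1 + p.2.1, p.1.2 + p.2.2), fun x hx => ?_⟩
  obtain ⟨p, hp, e⟩ := hS x hx
  obtain ⟨q, hq, e'⟩ := hT x hx
  refine ⟨_, Finset.mem_image_of_mem _ (Finset.mk_mem_product hp hq), ?_⟩
  simp only [e, e']
  push_cast
  ring

lemma comp {Y : Type*} {t : Set Y} {d w : Y → ℝ} {k : X → Y} (hw : HasIntPieces t d w)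
    (hk : MapsTo k s t) (hd : HasIntPieces s c (fun x => d (k x))) :
    HasIntPieces s c (fun x => w (k x)) := by
  classical
  obtain ⟨S, hS⟩ := hw
  obtain ⟨T, hT⟩ := hd
  refine ⟨(S ×ˢ T).image fun p => (p.1.1 * p.2.1, p.1.1 * p.2.2 + p.1.2), fun x hx => ?_⟩
  obtain ⟨p, hp, e⟩ := hS _ (hk hx)
  obtain ⟨q, hq, e'⟩ := hT x hx
  refine ⟨_, Finset.mem_image_of_mem _ (Finset.mk_mem_product hp hq), ?_⟩
  simp only [e] at e' ⊢
  simp only [e']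
  push_cast
  ring

end HasIntPieces

/-! ### Z-maps on `[0,1/2]` with a left inverse Z-map -/

/-- If `u` and `v` both have finitely many integer affine pieces and `v (u t) = t`, then the slopes
of `u` are `±1`, so a continuous `u` with values in `[0,1]` is `t` or `1 - t` on `[0,1/2]`. -/
lemma eq_self_or_eq_one_sub {u v : ℝ → ℝ} (hc : ContinuousOn u (Icc 0 (1 / 2)))
    (hu : HasIntPieces (Icc 0 (1 / 2)) id u) (hv : HasIntPieces (Icc 0 1) id v)
    (hmaps : MapsTo u (Icc 0 (1 / 2)) (Icc 0 1)) (hvu : ∀ t ∈ Icc (0 : ℝ) (1 / 2), v (u t) = t) :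
    (∀ t ∈ Icc (0 : ℝ) (1 / 2), u t = t) ∨ (∀ t ∈ Icc (0 : ℝ) (1 / 2), u t = 1 - t) := by
  classical
  obtain ⟨S, hS⟩ := hu
  obtain ⟨T, hT⟩ := hv
  let E : Set ℝ := ((S ×ˢ T).image fun p : (ℤ × ℤ) × (ℤ × ℤ) =>
    (-(p.2.1 * p.1.2 + p.2.2) / (p.2.1 * p.1.1 - 1) : ℝ))
  have hE : E.Finite := Finset.finite_toSet _
  have generic : ∀ t ∈ Ioo (0 : ℝ) (1 / 2) \ E, u t = t ∨ u t = 1 - t := by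
    rintro t ⟨⟨ht₀, ht₁⟩, htE⟩
    have ht : t ∈ Icc (0 : ℝ) (1 / 2) := ⟨ht₀.le, ht₁.le⟩
    obtain ⟨p, hp, e⟩ := hS t ht
    obtain ⟨q, hq, e'⟩ := hT _ (hmaps ht)
    obtain ⟨h₀, h₁⟩ := hmaps ht
    simp only [id, hvu t ht] at e e'
    have hslope : q.1 * p.1 = 1 := by
      by_contra hne
      apply htE
      refine Finset.mem_coe.2 (Finset.mem_image.2 ⟨(p, q), Finset.mk_mem_product hp hq, ?_⟩)
      have hne' : (q.1 * p.1 - 1 : ℝ) ≠ 0 := by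
        rw [sub_ne_zero]
        exact_mod_cast hne
      rw [div_eq_iff hne']
      rw [e] at e'
      linear_combination e'
    rcases Int.isUnit_iff.1 (IsUnit.of_mul_eq_one_right _ hslope) with h | h
    · rw [h] at e
      have h1 : p.2 < 1 := by
        have : (p.2 : ℝ) < 1 := by push_cast at e; linarith
        exact_mod_cast this
      have h2 : -1 < p.2 := by
        have : (-1 : ℝ) < p.2 := by push_cast at e; linarith
        exact_mod_cast this
      have h3 : p.2 = 0 := by lia
      left
      rw [e, h3]
      simp
    · rw [h] at e
      have h1 : p.2 < 2 := by
        have : (p.2 : ℝ) < 2 := by push_cast at e; linarith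
        exact_mod_cast this
      have h2 : 0 < p.2 := by
        have : (0 : ℝ) < p.2 := by push_cast at e; linarith
        exact_mod_cast this
      have h3 : p.2 = 1 := by lia
      right
      rw [e, h3]
      push_cast
      ring
  have hdense : Icc (0 : ℝ) (1 / 2) ⊆ closure (Ioo (0 : ℝ) (1 / 2) \ E) := by
    have hd : Dense Eᶜ := hE.countable.dense_compl ℝ
    rw [sdiff_eq, ← closure_Ioo (by norm_num)]
    exact closure_minimal (hd.open_subset_closure_inter isOpen_Ioo) isClosed_closure
  have key : ∀ t ∈ Icc (0 : ℝ) (1 / 2), (u t - t) * (u t - (1 - t)) = 0 := by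
    have hcont : ContinuousOn (fun t => (u t - t) * (u t - (1 - t))) (Icc 0 (1 / 2)) := by
      fun_prop
    intro t ht
    have h0 : EqOn (fun t => (u t - t) * (u t - (1 - t))) (fun _ => 0)
        (Ioo (0 : ℝ) (1 / 2) \ E) := by
      intro t ht
      rcases generic t ht with h | h <;> simp [h]
    exact h0.of_subset_closure hcont continuousOn_const
      (sdiff_subset.trans Ioo_subset_Icc_self) hdense ht
  have dich : ∀ t ∈ Icc (0 : ℝ) (1 / 2), u t = t ∨ u t = 1 - t := fun t ht => by
    rcases mul_eq_zero.1 (key t ht) with h | h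
    · exact Or.inl (by linarith)
    · exact Or.inr (by linarith)
  have halves : (∀ t ∈ Ico (0 : ℝ) (1 / 2), u t < 1 / 2) ∨
      (∀ t ∈ Ico (0 : ℝ) (1 / 2), 1 / 2 < u t) := by
    by_contra! h
    obtain ⟨⟨a, ha, hua⟩, b, hb, hub⟩ := h
    obtain ⟨t, ht, hut⟩ := isPreconnected_Ico.intermediate_value hb ha
      (hc.mono Ico_subset_Icc_self) ⟨hub, hua⟩
    rcases dich t (Ico_subset_Icc_self ht) with h | h <;> linarith [ht.2]
  rcases halves with h | h
  · left
    intro t ht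
    rcases ht.2.eq_or_lt with rfl | h'
    · rcases dich _ ht with h | h <;> linarith
    · rcases dich _ ht with h'' | h''
      · exact h''
      · linarith [h t ⟨ht.1, h'⟩]
  · right
    intro t ht
    rcases ht.2.eq_or_lt with rfl | h'
    · rcases dich _ ht with h | h <;> linarith
    · rcases dich _ ht with h'' | h''
      · linarith [h t ⟨ht.1, h'⟩]
      · exact h''

/-! ### The algebra `McN 1` -/

lemma mcn_nonneg (f : McN 1) (x : cubeSet 1) : 0 ≤ f.1 x := (f.2.1 x).1

lemma mcn_le_one (f : McN 1) (x : cubeSet 1) : f.1 x ≤ 1 := (f.2.1 x).2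

lemma mcn_continuous (f : McN 1) : Continuous f.1 := (mem_McN_one_iff.1 f.2).2.1

lemma mcn_hasIntPieces (f : McN 1) : HasIntPieces univ (fun x : cubeSet 1 => x.1 0) f.1 :=
  (mem_McN_one_iff.1 f.2).2.2

lemma mvNeg_mem (f : McN 1) : mvNeg f.1 ∈ McN 1 := by
  refine mem_McN_one_iff.2 ⟨fun x => ?_, ?_, ?_⟩
  · have := mcn_nonneg f x
    have := mcn_le_one f x
    constructor <;> simp only [mvNeg] <;> linarith
  · have := mcn_continuous f
    unfold mvNeg
    fun_prop
  · exact (HasIntPieces.of_affine (s := univ) (c := id) (v := fun t : ℝ => 1 - t) (-1) 1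
      (fun t _ => by simp; ring)).comp (mapsTo_univ _ _) (mcn_hasIntPieces f)

lemma mvAdd_mem (f g : McN 1) : mvAdd f.1 g.1 ∈ McN 1 := by
  refine mem_McN_one_iff.2 ⟨fun x => ?_, ?_, ?_⟩
  · have := mcn_nonneg f x
    have := mcn_nonneg g x
    exact ⟨le_min (by linarith) zero_le_one, min_le_right _ _⟩
  · have := mcn_continuous f
    have := mcn_continuous g
    unfold mvAdd
    fun_prop
  · exact ((mcn_hasIntPieces f).add (mcn_hasIntPieces g)).of_or
      (HasIntPieces.of_affine (v := fun _ => 1) 0 1 (fun _ _ => by simp)) fun x _ => min_choice _ _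

/-- Negation in `McN 1`. -/
def mcnNeg (f : McN 1) : McN 1 := ⟨mvNeg f.1, mvNeg_mem f⟩

/-- Truncated sum in `McN 1`. -/
def mcnAdd (f g : McN 1) : McN 1 := ⟨mvAdd f.1 g.1, mvAdd_mem f g⟩

/-- The identity function of `[0,1]`, as an element of `McN 1`. -/
def mcnId : McN 1 := ⟨fun x => x.1 0, mem_McN_one_iff.2 ⟨fun x => mem_cubeSet_one.1 x.2,
  (continuous_apply 0).comp continuous_subtype_val,
  HasIntPieces.of_affine 1 0 (fun _ _ => by simp)⟩⟩

/-- Composition `f ∘ r` of elements of `McN 1`. -/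
def mcnComp (f r : McN 1) : McN 1 := ⟨fun x => f.1 (clampPt (r.1 x)), mem_McN_one_iff.2
  ⟨fun _ => f.2.1 _, (mcn_continuous f).comp (continuous_clampPt.comp (mcn_continuous r)),
    (mcn_hasIntPieces f).comp (mapsTo_univ _ _) <| by
      simpa only [clampPt_apply (mcn_nonneg r _) (mcn_le_one r _)] using mcn_hasIntPieces r⟩⟩

lemma mcnComp_id_left (r : McN 1) : mcnComp mcnId r = r :=
  Subtype.ext <| funext fun x => clampPt_apply (mcn_nonneg r x) (mcn_le_one r x) 0

lemma mcnComp_assoc (f g r : McN 1) : mcnComp (mcnComp f g) r = mcnComp f (mcnComp g r) := rfl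

/-! ### Homomorphisms from `McN 1` to `[0,1]` are evaluations -/

lemma exists_nat_mul_add_int {a b : ℝ} (h : a < b) :
    ∃ (n : ℕ) (m : ℤ), n * a + m ≤ 0 ∧ 1 ≤ n * b + m := by
  obtain ⟨n, hn⟩ := exists_nat_gt (2 / (b - a))
  rw [div_lt_iff₀ (sub_pos.2 h)] at hn
  refine ⟨n, ⌊-(n * a)⌋, ?_, ?_⟩
  · linarith [Int.floor_le (-(n * a))]
  · linarith [Int.lt_floor_add_one (-(n * a))]

lemma clamp_add_eq {w t : ℝ} (h₀ : 0 ≤ t) (h₁ : t ≤ 1) :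
    max 0 (min (w + t) 1) = 1 - min ((1 - min (max 0 (min w 1) + t) 1) +
      (1 - max 0 (min (w + 1) 1))) 1 := by
  grind

/-- An MV-homomorphism from `McN 1` to `[0,1]`. -/
structure IsMVState (φ : McN 1 → ℝ) : Prop where
  nonneg : ∀ f, 0 ≤ φ f
  le_one : ∀ f, φ f ≤ 1
  map_add : ∀ f g, φ (mcnAdd f g) = min (φ f + φ g) 1
  map_neg : ∀ f, φ (mcnNeg f) = 1 - φ f

namespace IsMVState

variable {φ : McN 1 → ℝ}

lemma eq_one_of_forall (hφ : IsMVState φ) {f : McN 1} (hf : ∀ x, f.1 x = 1) : φ f = 1 := by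
  have : f = mcnAdd f (mcnNeg f) := by
    ext x
    simp [mcnAdd, mvAdd, mcnNeg, mvNeg, hf]
  rw [this, hφ.map_add, hφ.map_neg]
  simp

/-- A homomorphism commutes with all truncated integer affine functions. -/
lemma exists_clamp (hφ : IsMVState φ) (f : McN 1) (n : ℕ) (m : ℤ) :
    ∃ F : McN 1, (∀ x, F.1 x = max 0 (min (n * f.1 x + m) 1)) ∧
      φ F = max 0 (min (n * φ f + m) 1) := by
  induction n generalizing m with
  | zero =>
    have hone : ∀ x, (mcnAdd f (mcnNeg f)).1 x = 1 := fun x => by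
      simp [mcnAdd, mvAdd, mcnNeg, mvNeg]
    rcases le_or_gt m 0 with h | h
    · have h' : (m : ℝ) ≤ 0 := by exact_mod_cast h
      have e : max 0 (min (m : ℝ) 1) = 0 := max_eq_left (min_le_of_left_le h')
      refine ⟨mcnNeg (mcnAdd f (mcnNeg f)), fun x => ?_, ?_⟩
      · simp only [CharP.cast_eq_zero, zero_mul, zero_add, e]
        change 1 - (mcnAdd f (mcnNeg f)).1 x = 0
        rw [hone, sub_self]
      · rw [hφ.map_neg, hφ.eq_one_of_forall hone]
        simp [e]
    · have h' : (1 : ℝ) ≤ m := by exact_mod_cast h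
      have e : max 0 (min (m : ℝ) 1) = 1 := by rw [min_eq_right h']; simp
      refine ⟨mcnAdd f (mcnNeg f), fun x => ?_, ?_⟩
      · rw [hone]
        simp [e]
      · rw [hφ.eq_one_of_forall hone]
        simp [e]
  | succ n ih =>
    obtain ⟨F, hF, hF'⟩ := ih m
    obtain ⟨G, hG, hG'⟩ := ih (m + 1)
    refine ⟨mcnNeg (mcnAdd (mcnNeg (mcnAdd F f)) (mcnNeg G)), fun x => ?_, ?_⟩
    · have := clamp_add_eq (w := n * f.1 x + m) (mcn_nonneg f x) (mcn_le_one f x)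
      simp only [mcnNeg, mcnAdd, mvNeg, mvAdd, hF, hG]
      push_cast
      rw [show ((n : ℝ) + 1) * f.1 x + m = n * f.1 x + m + f.1 x by ring, ← add_assoc, this]
    · have := clamp_add_eq (w := n * φ f + m) (hφ.nonneg f) (hφ.le_one f)
      simp only [hφ.map_neg, hφ.map_add, hF', hG']
      push_cast
      rw [show ((n : ℝ) + 1) * φ f + m = n * φ f + m + φ f by ring, ← add_assoc, this]

/-- An element separating `a` from `b`: it is killed by `φ`, and equal to `1` where `f ≥ b`. -/
lemma exists_separating (hφ : IsMVState φ) (f : McN 1) {b : ℝ} (h : φ f < b) :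
    ∃ F : McN 1, φ F = 0 ∧ ∀ x, b ≤ f.1 x → F.1 x = 1 := by
  obtain ⟨n, m, hn, hm⟩ := exists_nat_mul_add_int h
  obtain ⟨F, hF, hF'⟩ := hφ.exists_clamp f n m
  refine ⟨F, ?_, fun x hx => ?_⟩
  · rw [hF', max_eq_left (min_le_of_left_le hn)]
  · rw [hF, min_eq_right, max_eq_right zero_le_one]
    have : (n : ℝ) * b ≤ n * f.1 x := by gcongr
    linarith

lemma apply_le (hφ : IsMVState φ) (f : McN 1) : f.1 (clampPt (φ mcnId)) ≤ φ f := by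
  by_contra! h
  set y := φ mcnId with hy
  obtain ⟨b, hb, hb'⟩ := exists_between h
  have hcont : Continuous fun t : ℝ => f.1 (clampPt t) :=
    (mcn_continuous f).comp continuous_clampPt
  obtain ⟨δ, hδ, hball⟩ := Metric.eventually_nhds_iff.1
    (hcont.continuousAt.eventually (lt_mem_nhds hb'))
  obtain ⟨F, hF, hF'⟩ := hφ.exists_separating f hb
  obtain ⟨G, hG, hG'⟩ := hφ.exists_separating mcnId (b := y + δ) (by linarith)
  obtain ⟨H, hH, hH'⟩ := hφ.exists_separating (mcnNeg mcnId) (b := 1 - y + δ)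
    (by rw [hφ.map_neg]; linarith)
  have hone : φ (mcnAdd F (mcnAdd G H)) = 1 := by
    refine hφ.eq_one_of_forall fun x => ?_
    have h1 := mcn_nonneg F x
    have h2 := mcn_nonneg G x
    have h3 := mcn_nonneg H x
    change min (F.1 x + min (G.1 x + H.1 x) 1) 1 = 1
    have h4 : 0 ≤ min (G.1 x + H.1 x) 1 := le_min (by linarith) zero_le_one
    rcases le_or_gt (y + δ) (x.1 0) with hx | hx
    · rw [hG' x hx, min_eq_right (a := 1 + H.1 x) (by linarith), min_eq_right (by linarith)]
    rcases le_or_gt (x.1 0) (y - δ) with hx' | hx'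
    · have : (mcnNeg mcnId).1 x = 1 - x.1 0 := rfl
      rw [hH' x (by linarith), min_eq_right (a := G.1 x + 1) (by linarith),
        min_eq_right (by linarith)]
    · have := hball (y := x.1 0) (by rw [Real.dist_eq, abs_lt]; constructor <;> linarith)
      rw [clampPt_coord] at this
      rw [hF' x this.le, min_eq_right (by linarith)]
  rw [hφ.map_add, hφ.map_add, hF, hG, hH] at hone
  norm_num at hone

lemma eq_apply (hφ : IsMVState φ) (f : McN 1) : φ f = f.1 (clampPt (φ mcnId)) := by
  refine le_antisymm ?_ (hφ.apply_le f)
  have := hφ.apply_le (mcnNeg f)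
  rw [hφ.map_neg] at this
  change 1 - f.1 _ ≤ _ at this
  linarith

end IsMVState

/-! ### Retractions of `McN 1` -/

lemma IsMcNRetraction.eq_mcnComp {ε : McN 1 → McN 1} {A : Set (cubeSet 1 → ℝ)}
    (h : IsMcNRetraction ε A) (f : McN 1) : ε f = mcnComp f (ε mcnId) := by
  ext x
  have hφ : IsMVState fun f => (ε f).1 x :=
    { nonneg := fun f => mcn_nonneg _ x
      le_one := fun f => mcn_le_one _ x
      map_add := fun f g => congrFun (h.1 f g (mvAdd_mem f g)) x
      map_neg := fun f => congrFun (h.2.1 f (mvNeg_mem f)) x }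
  exact hφ.eq_apply f

lemma isMcNRetraction_mcnComp {r : McN 1} (hr : mcnComp r r = r) {A : Set (cubeSet 1 → ℝ)}
    (hA : Subtype.val '' range (fun f => mcnComp f r) = A) :
    IsMcNRetraction (fun f => mcnComp f r) A :=
  ⟨fun _ _ _ => rfl, fun _ _ => rfl, fun f => congrArg (mcnComp f) hr, hA⟩

lemma retAlg_eq_of_mapsTo {σ : (Fin 1 → ℝ) → (Fin 1 → ℝ)} (hσ : MapsTo σ (cubeSet 1) (cubeSet 1))
    {s : McN 1} (hs : ∀ x, s.1 x = σ x.1 0) :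
    retAlg σ = Subtype.val '' range (fun f => mcnComp f s) := by
  have key : ∀ (g : McN 1) (x : cubeSet 1), (mcnComp g s).1 x = g.1 ⟨σ x.1, hσ x.2⟩ :=
    fun g x => congrArg g.1 (clampPt_eq (hσ x.2) (hs x).symm)
  ext f
  constructor
  · rintro ⟨g, hg, hf⟩
    exact ⟨_, ⟨⟨g, hg⟩, rfl⟩, funext fun x => (key ⟨g, hg⟩ x).trans (hf x (hσ x.2)).symm⟩
  · rintro ⟨_, ⟨g, rfl⟩, rfl⟩
    exact ⟨g.1, g.2, fun x _ => key g x⟩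

/-- If `s` is a Z-retraction onto `[0,1/2]`, then the only candidates for retractions onto the
algebra of all `f ∘ s` are the substitutions of `s` and of `1 - s`. -/
lemma IsMcNRetraction.eq_or_eq {ε : McN 1 → McN 1} {s : McN 1}
    (hs : ∀ x, s.1 x ≤ 1 / 2) (hs' : ∀ x : cubeSet 1, x.1 0 ≤ 1 / 2 → s.1 x = x.1 0)
    (h : IsMcNRetraction ε (Subtype.val '' range (fun f => mcnComp f s))) :
    mcnComp (ε mcnId) (ε mcnId) = ε mcnId ∧ (ε mcnId = s ∨ ε mcnId = mcnNeg s) := by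
  set r := ε mcnId with hr
  have hε : ∀ f, ε f = mcnComp f r := h.eq_mcnComp
  have hrange : range ε = range (fun f => mcnComp f s) :=
    image_injective.2 Subtype.val_injective h.2.2.2
  refine ⟨?_, ?_⟩
  · rw [← hε, hr, h.2.2.1]
  obtain ⟨a, ha⟩ : r ∈ range (fun f => mcnComp f s) := hrange ▸ mem_range_self mcnId
  obtain ⟨b, hb⟩ : s ∈ range ε := hrange ▸ ⟨mcnId, mcnComp_id_left s⟩
  replace ha : mcnComp a s = r := ha
  rw [hε] at hb
  have hss : mcnComp s s = s := by
    ext x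
    change s.1 (clampPt (s.1 x)) = _
    have e := clampPt_apply (mcn_nonneg s x) (mcn_le_one s x) 0
    rw [hs' _ (by rw [e]; exact hs x), e]
  have hrs : mcnComp r s = r := by rw [← ha, mcnComp_assoc, hss]
  have cl : ∀ t ∈ Icc (0 : ℝ) 1, (clampPt t).1 0 = t := fun t ht => clampPt_apply ht.1 ht.2 0
  have hsub : Icc (0 : ℝ) (1 / 2) ⊆ Icc 0 1 := Icc_subset_Icc_right (by norm_num)
  have pieces : ∀ f : McN 1, HasIntPieces (Icc 0 1) id (fun t => f.1 (clampPt t)) := fun f =>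
    (mcn_hasIntPieces f).comp (mapsTo_univ _ _)
      (HasIntPieces.of_affine 1 0 fun t ht => by simp [cl t ht])
  have main := eq_self_or_eq_one_sub (u := fun t => r.1 (clampPt t))
    (v := fun t => b.1 (clampPt t))
    ((mcn_continuous r).comp continuous_clampPt).continuousOn
    (by obtain ⟨S, hS⟩ := pieces r; exact ⟨S, fun t ht => hS t (hsub ht)⟩)
    (pieces b) (fun t _ => ⟨mcn_nonneg r _, mcn_le_one r _⟩)
    (fun t ht => by
      have e := cl t (hsub ht)
      have : s.1 (clampPt t) = t := by rw [hs' _ (by rw [e]; exact ht.2), e]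
      exact (congrFun (congrArg Subtype.val hb) (clampPt t)).trans this)
  refine main.imp (fun H => ?_) (fun H => ?_)
  · ext x
    rw [← hrs]
    exact H _ ⟨mcn_nonneg s x, hs x⟩
  · ext x
    rw [← hrs]
    exact H _ ⟨mcn_nonneg s x, hs x⟩

/-! ### Z-retractions onto `[0,1/2]` -/

lemma isRationalPolyhedron_seg (a b : ℚ) (h : a ≤ b) : IsRationalPolyhedron (seg a b) := by
  classical
  refine ⟨{{fun _ => (a : ℝ), fun _ => (b : ℝ)}}, ?_, ?_⟩
  · simp only [Finset.mem_singleton, forall_eq, Finset.mem_insert]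
    rintro v (rfl | rfl) i
    exacts [⟨a, rfl⟩, ⟨b, rfl⟩]
  · have h' : (a : ℝ) ≤ b := by exact_mod_cast h
    simp only [Finset.mem_singleton, iUnion_iUnion_eq_left, Finset.coe_insert,
      Finset.coe_singleton, convexHull_pair]
    ext v
    constructor
    · intro hv
      have hv' : v 0 ∈ segment ℝ (a : ℝ) b := by rwa [segment_eq_Icc h']
      obtain ⟨α, β, hα, hβ, hαβ, e⟩ := hv'
      refine ⟨α, β, hα, hβ, hαβ, ?_⟩
      ext i
      rw [Subsingleton.elim i 0, ← e]
      rfl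
    · rintro ⟨α, β, hα, hβ, hαβ, rfl⟩
      have : α • (a : ℝ) + β • (b : ℝ) ∈ Icc (a : ℝ) b := by
        rw [← segment_eq_Icc h']
        exact ⟨α, β, hα, hβ, hαβ, rfl⟩
      exact this

/-- `σ` is a Z-map of `[0,1]` into `[0,1/2]` that fixes `[0,1/2]` pointwise. -/
structure IsHalfRetraction (σ : (Fin 1 → ℝ) → (Fin 1 → ℝ)) : Prop where
  isZMapOn : IsZMapOn (cubeSet 1) σ
  mapsTo : MapsTo σ (cubeSet 1) (seg 0 (1 / 2))
  eq_self : ∀ v ∈ seg 0 (1 / 2), σ v = v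

lemma seg_subset_cubeSet : seg 0 (1 / 2) ⊆ cubeSet 1 :=
  fun _ hv => mem_cubeSet_one.2 ⟨hv.1, by linarith [hv.2]⟩

lemma IsZMapOn.mono {P Q : Set (Fin 1 → ℝ)} {f : (Fin 1 → ℝ) → (Fin 1 → ℝ)}
    (h : IsZMapOn P f) (hQ : Q ⊆ P) : IsZMapOn Q f := by
  obtain ⟨hc, k, g, hg, hf⟩ := h
  exact ⟨hc.mono hQ, k, g, hg, fun x hx => hf x (hQ hx)⟩

lemma exists_coord_eq (v : Fin 1 → ℝ) : ∃ t : ℝ, v = fun _ => t :=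
  ⟨v 0, funext fun i => by rw [Subsingleton.elim i 0]⟩

namespace IsHalfRetraction

variable {σ τ : (Fin 1 → ℝ) → (Fin 1 → ℝ)}

lemma mapsTo_cubeSet (hσ : IsHalfRetraction σ) : MapsTo σ (cubeSet 1) (cubeSet 1) :=
  hσ.mapsTo.mono_right seg_subset_cubeSet

lemma isZRetraction (hσ : IsHalfRetraction σ) : IsZRetraction σ :=
  ⟨hσ.isZMapOn, hσ.mapsTo_cubeSet, fun _ hv => hσ.eq_self _ (hσ.mapsTo hv)⟩

lemma zRange_eq (hσ : IsHalfRetraction σ) : zRange σ = seg 0 (1 / 2) :=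
  Subset.antisymm hσ.mapsTo.image_subset fun v hv => ⟨v, seg_subset_cubeSet hv, hσ.eq_self v hv⟩

lemma isZHomeoDomain_seg (hσ : IsHalfRetraction σ) : IsZHomeoDomain σ (seg 0 (1 / 2)) := by
  refine ⟨by simpa using isRationalPolyhedron_seg 0 (1 / 2) (by norm_num), seg_subset_cubeSet,
    hσ.isZMapOn.mono seg_subset_cubeSet, ?_, ?_, id, ?_, hσ.eq_self, ?_⟩
  · rw [hσ.zRange_eq, image_congr hσ.eq_self, image_id']
  · intro v hv w hw h
    rwa [hσ.eq_self v hv, hσ.eq_self w hw] at h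
  · exact isZMapOn_iff.2 ⟨continuousOn_id, HasIntPieces.of_affine 1 0 fun _ _ => by simp⟩
  · rw [hσ.zRange_eq]
    exact hσ.eq_self

lemma eq_seg_or_of_isZHomeoDomain (hσ : IsHalfRetraction σ) {Q : Set (Fin 1 → ℝ)}
    (hQ : IsZHomeoDomain σ Q) : Q = seg 0 (1 / 2) ∨
      (Q = seg (1 / 2) 1 ∧ ∀ t ∈ Icc (0 : ℝ) (1 / 2), σ (fun _ => 1 - t) = fun _ => t) := by
  obtain ⟨-, hsub, -, himg, -, g, hg, hgσ, hσg⟩ := hQ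
  rw [hσ.zRange_eq] at himg hg hσg
  have hmem : ∀ t ∈ Icc (0 : ℝ) (1 / 2), g (fun _ => t) ∈ Q := by
    intro t ht
    obtain ⟨x, hx, e⟩ : (fun _ => t) ∈ σ '' Q := himg ▸ ht
    rw [← e, hgσ x hx]
    exact hx
  have hσQ : ∀ x ∈ Q, ∃ t ∈ Icc (0 : ℝ) (1 / 2), x = g (fun _ => t) := by
    intro x hx
    obtain ⟨t, ht⟩ := exists_coord_eq (σ x)
    have := hσ.mapsTo (hsub hx)
    rw [ht] at this
    exact ⟨t, this, by rw [← ht, hgσ x hx]⟩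
  obtain ⟨hgc, hgp⟩ := isZMapOn_iff.1 hg
  obtain ⟨-, hσp⟩ := isZMapOn_iff.1 hσ.isZMapOn
  have hconst : Continuous fun (t : ℝ) (_ : Fin 1) => t := by fun_prop
  have main := eq_self_or_eq_one_sub (u := fun t => g (fun _ => t) 0)
    (v := fun t => σ (fun _ => t) 0)
    ((continuous_apply 0).comp_continuousOn (hgc.comp hconst.continuousOn fun t ht => ht))
    (hgp.comp (fun t ht => ht) (HasIntPieces.of_affine 1 0 fun _ _ => by simp))
    (hσp.comp (fun t ht => mem_cubeSet_one.2 ht) (HasIntPieces.of_affine 1 0 fun _ _ => by simp))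
    (fun t ht => mem_cubeSet_one.1 (hsub (hmem t ht)))
    (fun t ht => by
      have : (fun _ : Fin 1 => g (fun _ => t) 0) = g (fun _ => t) :=
        funext fun i => by rw [Subsingleton.elim i 0]
      change σ (fun _ : Fin 1 => g (fun _ => t) 0) 0 = t
      rw [this, hσg _ ht])
  have upgrade : ∀ {w : ℝ → ℝ}, (∀ t ∈ Icc (0 : ℝ) (1 / 2), g (fun _ => t) 0 = w t) →
      ∀ t ∈ Icc (0 : ℝ) (1 / 2), g (fun _ => t) = fun _ => w t := fun h t ht =>
    funext fun i => by rw [Subsingleton.elim i 0, h t ht]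
  refine main.imp (fun H => ?_) (fun H => ?_)
  · replace H := upgrade H
    refine Subset.antisymm (fun x hx => ?_) (fun x hx => ?_)
    · obtain ⟨t, ht, rfl⟩ := hσQ x hx
      rw [H t ht]
      exact ht
    · obtain ⟨t, rfl⟩ := exists_coord_eq x
      have := hmem t hx
      rwa [H t hx] at this
  · replace H := upgrade H
    refine ⟨Subset.antisymm (fun x hx => ?_) (fun x hx => ?_), fun t ht => ?_⟩
    · obtain ⟨t, ht, rfl⟩ := hσQ x hx
      rw [H t ht]
      exact ⟨by linarith [ht.2], by linarith [ht.1]⟩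
    · obtain ⟨t, rfl⟩ := exists_coord_eq x
      have ht : 1 - t ∈ Icc (0 : ℝ) (1 / 2) := ⟨by linarith [hx.2], by linarith [hx.1]⟩
      have := hmem _ ht
      rwa [H _ ht, sub_sub_cancel] at this
    · have := hσg (fun _ => t) ht
      rwa [H t ht] at this

/-- `σ` as an element of `McN 1`. -/
def toMcN (hσ : IsHalfRetraction σ) : McN 1 := ⟨fun x => σ x.1 0, by
  obtain ⟨hc, S, hS⟩ := isZMapOn_iff.1 hσ.isZMapOn
  exact mem_McN_one_iff.2 ⟨fun x => mem_cubeSet_one.1 (hσ.mapsTo_cubeSet x.2),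
    (continuous_apply 0).comp (continuousOn_iff_continuous_domRestrict.1 hc),
    S, fun x _ => hS x.1 x.2⟩⟩

lemma toMcN_le (hσ : IsHalfRetraction σ) (x : cubeSet 1) : hσ.toMcN.1 x ≤ 1 / 2 :=
  (hσ.mapsTo x.2).2

lemma toMcN_eq_self (hσ : IsHalfRetraction σ) (x : cubeSet 1) (hx : x.1 0 ≤ 1 / 2) :
    hσ.toMcN.1 x = x.1 0 :=
  congrFun (hσ.eq_self x.1 ⟨(mem_cubeSet_one.1 x.2).1, hx⟩) 0

lemma mcnComp_toMcN (hσ : IsHalfRetraction σ) (hτ : IsHalfRetraction τ) :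
    mcnComp hσ.toMcN hτ.toMcN = hτ.toMcN := by
  ext x
  have e := clampPt_apply (mcn_nonneg hτ.toMcN x) (mcn_le_one hτ.toMcN x) 0
  exact (hσ.toMcN_eq_self _ (by rw [e]; exact hτ.toMcN_le x)).trans e

lemma retAlg_eq (hσ : IsHalfRetraction σ) :
    retAlg σ = Subtype.val '' range (fun f => mcnComp f hσ.toMcN) :=
  retAlg_eq_of_mapsTo hσ.mapsTo_cubeSet fun _ => rfl

lemma isMcNRetraction (hσ : IsHalfRetraction σ) :
    IsMcNRetraction (fun f => mcnComp f hσ.toMcN) (retAlg σ) :=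
  isMcNRetraction_mcnComp (hσ.mcnComp_toMcN hσ) hσ.retAlg_eq.symm

lemma eq_or_eq_of_isMcNRetraction (hσ : IsHalfRetraction σ) {ε : McN 1 → McN 1}
    (h : IsMcNRetraction ε (retAlg σ)) : ε = (fun f => mcnComp f hσ.toMcN) ∨
      (mcnComp (mcnNeg hσ.toMcN) (mcnNeg hσ.toMcN) = mcnNeg hσ.toMcN ∧
        ε = fun f => mcnComp f (mcnNeg hσ.toMcN)) := by
  have hε := h.eq_mcnComp
  rw [hσ.retAlg_eq] at h
  obtain ⟨hidem, e | e⟩ := h.eq_or_eq hσ.toMcN_le hσ.toMcN_eq_self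
  · rw [e] at hε
    exact Or.inl (funext hε)
  · rw [e] at hε hidem
    exact Or.inr ⟨hidem, funext hε⟩

/-- Any two Z-retractions onto `[0,1/2]` have isomorphic algebras. -/
lemma exists_isMVIsoFun (hσ : IsHalfRetraction σ) (hτ : IsHalfRetraction τ) :
    ∃ h : retAlg σ → retAlg τ, IsMVIsoFun (retAlg σ) (retAlg τ) h := by
  rw [hσ.retAlg_eq, hτ.retAlg_eq]
  set s := hσ.toMcN
  set t := hτ.toMcN
  have hst : mcnComp s t = t := hσ.mcnComp_toMcN hτ
  have hts : mcnComp t s = s := hτ.mcnComp_toMcN hσ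
  have hss : mcnComp s s = s := hσ.mcnComp_toMcN hσ
  refine ⟨fun f => ⟨fun x => f.1 (clampPt (t.1 x)), ?_⟩, ⟨?_, ?_⟩, fun _ _ _ => rfl,
    fun _ _ => rfl⟩
  · obtain ⟨_, _, ⟨g, rfl⟩, rfl⟩ := f
    exact ⟨_, ⟨g, rfl⟩, congrArg (fun r => (mcnComp g r).1) hst.symm⟩
  · rintro ⟨_, _, ⟨f, rfl⟩, rfl⟩ ⟨_, _, ⟨g, rfl⟩, rfl⟩ h
    have h' : mcnComp (mcnComp f s) t = mcnComp (mcnComp g s) t :=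
      Subtype.ext (congrArg (fun k => k.1) h)
    simp only [mcnComp_assoc, hst] at h'
    have h'' := congrArg (fun r => mcnComp r s) h'
    simp only [mcnComp_assoc, hts] at h''
    simp only [h'']
  · rintro ⟨_, _, ⟨f, rfl⟩, rfl⟩
    exact ⟨⟨_, _, ⟨f, rfl⟩, rfl⟩, Subtype.ext (congrArg (fun r => (mcnComp f r).1) hst)⟩

end IsHalfRetraction

/-! ### The retractions `σ` and `τ` -/

lemma sigma10_eq (v : Fin 1 → ℝ) : sigma10 v = fun _ => min (v 0) (1 - v 0) :=
  funext fun i => by simp [sigma10]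

lemma tau10_eq (v : Fin 1 → ℝ) : tau10 v = fun _ => if v 0 ≤ 1/2 then v 0 else
    if v 0 ≤ 2/3 then 1 - v 0 else if v 0 ≤ 3/4 then 3 - 4 * v 0 else 0 :=
  funext fun i => by simp [tau10]

lemma hasIntPieces_one_sub (P : Set (Fin 1 → ℝ)) :
    HasIntPieces P (fun v => v 0) (fun v => 1 - v 0) :=
  HasIntPieces.of_affine (-1) 1 fun _ _ => by push_cast; ring

lemma hasIntPieces_id (P : Set (Fin 1 → ℝ)) : HasIntPieces P (fun v => v 0) (fun v => v 0) :=
  HasIntPieces.of_affine 1 0 fun _ _ => by simp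

lemma isHalfRetraction_sigma10 : IsHalfRetraction sigma10 where
  isZMapOn := isZMapOn_iff.2 ⟨by
    rw [funext sigma10_eq]
    fun_prop, (hasIntPieces_id _).of_or (hasIntPieces_one_sub _) fun v _ => by
      rw [sigma10_eq]
      exact min_choice _ _⟩
  mapsTo v hv := by
    obtain ⟨h₀, h₁⟩ := mem_cubeSet_one.1 hv
    rw [sigma10_eq]
    refine ⟨le_min h₀ (by linarith), ?_⟩
    grind
  eq_self v hv := by
    obtain ⟨t, rfl⟩ := exists_coord_eq v
    rw [sigma10_eq]
    exact funext fun _ => min_eq_left (by linarith [hv.2])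

lemma isHalfRetraction_tau10 : IsHalfRetraction tau10 where
  isZMapOn := isZMapOn_iff.2 ⟨by
    have hc : Continuous fun (v : Fin 1 → ℝ) (_ : Fin 1) =>
        max 0 (min (min (v 0) (1 - v 0)) (3 - 4 * v 0)) := by fun_prop
    refine hc.continuousOn.congr fun v hv => ?_
    obtain ⟨h₀, h₁⟩ := mem_cubeSet_one.1 hv
    rw [tau10_eq]
    ext i
    grind, by
    have h₁ : HasIntPieces (cubeSet 1) (fun v => v 0)
        (fun v => if v 0 ≤ 3/4 then 3 - 4 * v 0 else 0) :=
      (HasIntPieces.of_affine (v := fun v => 3 - 4 * v 0) (-4) 3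
        fun _ _ => by push_cast; ring).of_or
        (HasIntPieces.of_affine (v := fun _ => 0) 0 0 fun _ _ => by simp)
        fun _ _ => ite_eq_or_eq _ _ _
    have h₂ : HasIntPieces (cubeSet 1) (fun v => v 0) (fun v => if v 0 ≤ 2/3 then 1 - v 0 else
        if v 0 ≤ 3/4 then 3 - 4 * v 0 else 0) :=
      (hasIntPieces_one_sub _).of_or h₁ fun _ _ => ite_eq_or_eq _ _ _
    refine (hasIntPieces_id _).of_or h₂ fun v _ => ?_
    rw [tau10_eq]
    exact ite_eq_or_eq _ _ _⟩
  mapsTo v hv := by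
    obtain ⟨h₀, h₁⟩ := mem_cubeSet_one.1 hv
    rw [tau10_eq]
    constructor <;> grind
  eq_self v hv := by
    obtain ⟨t, rfl⟩ := exists_coord_eq v
    rw [tau10_eq]
    exact funext fun _ => if_pos hv.2

lemma isZHomeoDomain_sigma10_seg : IsZHomeoDomain sigma10 (seg (1 / 2) 1) := by
  have hsub : seg (1 / 2) 1 ⊆ cubeSet 1 :=
    fun v hv => mem_cubeSet_one.2 ⟨by linarith [hv.1], hv.2⟩
  have hσ : ∀ v ∈ seg (1 / 2) 1, sigma10 v = fun _ => 1 - v 0 := fun v hv => by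
    rw [sigma10_eq]
    exact funext fun _ => min_eq_right (by linarith [hv.1])
  have hinv : ∀ v : Fin 1 → ℝ, (fun _ : Fin 1 => 1 - (1 - v 0)) = v := fun v =>
    funext fun i => by rw [Subsingleton.elim i 0, sub_sub_cancel]
  have hmem : ∀ v ∈ seg 0 (1 / 2), (fun _ => 1 - v 0) ∈ seg (1 / 2) 1 := fun v hv =>
    ⟨by linarith [hv.2], by linarith [hv.1]⟩
  have hleft : ∀ v ∈ seg (1 / 2) 1, (fun _ : Fin 1 => 1 - sigma10 v 0) = v := fun v hv => by
    rw [hσ v hv, hinv]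
  have hright : ∀ v ∈ seg 0 (1 / 2), sigma10 (fun _ => 1 - v 0) = v := fun v hv => by
    rw [hσ _ (hmem v hv), hinv]
  refine ⟨by simpa using isRationalPolyhedron_seg (1 / 2) 1 (by norm_num), hsub,
    isHalfRetraction_sigma10.isZMapOn.mono hsub, ?_⟩
  rw [isHalfRetraction_sigma10.zRange_eq]
  refine ⟨Subset.antisymm (isHalfRetraction_sigma10.mapsTo.mono_left hsub).image_subset
      fun v hv => ⟨_, hmem v hv, hright v hv⟩, LeftInvOn.injOn (f₁' := fun w _ => 1 - w 0) hleft,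
    fun v _ => 1 - v 0, isZMapOn_iff.2 ⟨?_, hasIntPieces_one_sub _⟩, hleft, hright⟩
  fun_prop

lemma isMcNRetraction_mcnNeg_sigma10 :
    IsMcNRetraction (fun f => mcnComp f (mcnNeg isHalfRetraction_sigma10.toMcN))
      (retAlg sigma10) := by
  set s := isHalfRetraction_sigma10.toMcN with hs
  have hneg : ∀ r, mcnComp (mcnNeg mcnId) r = mcnNeg r := fun r =>
    congrArg mcnNeg (mcnComp_id_left r)
  have hnegneg : mcnNeg (mcnNeg s) = s := Subtype.ext (funext fun x => sub_sub_cancel _ _)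
  have hsn : mcnComp s (mcnNeg mcnId) = s := by
    ext x
    have e := clampPt_apply (mcn_nonneg (mcnNeg mcnId) x) (mcn_le_one (mcnNeg mcnId) x) 0
    change sigma10 (clampPt ((mcnNeg mcnId).1 x)).1 0 = sigma10 x.1 0
    rw [sigma10_eq, sigma10_eq, e]
    change min (1 - x.1 0) (1 - (1 - x.1 0)) = _
    rw [sub_sub_cancel, min_comm]
  have hss : mcnComp s s = s := isHalfRetraction_sigma10.mcnComp_toMcN isHalfRetraction_sigma10
  have hsns : mcnComp s (mcnNeg s) = s := by
    rw [← hneg s, ← mcnComp_assoc, hsn, hss]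
  refine isMcNRetraction_mcnComp (r := mcnNeg s) (congrArg mcnNeg hsns) ?_
  rw [isHalfRetraction_sigma10.retAlg_eq]
  congr 1
  apply Subset.antisymm
  · rintro _ ⟨f, rfl⟩
    exact ⟨mcnComp f (mcnNeg mcnId), by simp only [mcnComp_assoc, hneg, ← hs]⟩
  · rintro _ ⟨f, rfl⟩
    exact ⟨mcnComp f (mcnNeg mcnId), by simp only [mcnComp_assoc, hneg, hnegneg, ← hs]⟩

lemma setOf_isMcNRetraction_sigma10 : {ε | IsMcNRetraction ε (retAlg sigma10)} =
    {fun f => mcnComp f isHalfRetraction_sigma10.toMcN,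
      fun f => mcnComp f (mcnNeg isHalfRetraction_sigma10.toMcN)} := by
  ext ε
  constructor
  · exact fun h => (isHalfRetraction_sigma10.eq_or_eq_of_isMcNRetraction h).imp_right And.right
  · rintro (rfl | rfl)
    exacts [isHalfRetraction_sigma10.isMcNRetraction, isMcNRetraction_mcnNeg_sigma10]

lemma setOf_isMcNRetraction_tau10 : {ε | IsMcNRetraction ε (retAlg tau10)} =
    {fun f => mcnComp f isHalfRetraction_tau10.toMcN} := by
  ext ε
  refine ⟨fun h => (isHalfRetraction_tau10.eq_or_eq_of_isMcNRetraction h).resolve_right ?_, ?_⟩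
  · rintro ⟨h, -⟩
    have h' := congrFun (congrArg Subtype.val h) (clampPt (1 / 4))
    have e : (mcnNeg isHalfRetraction_tau10.toMcN).1 (clampPt (1 / 4)) = 3 / 4 := by
      change 1 - tau10 (clampPt (1 / 4)).1 0 = 3 / 4
      rw [tau10_eq, clampPt_apply (by norm_num) (by norm_num)]
      norm_num
    change (mcnNeg isHalfRetraction_tau10.toMcN).1
      (clampPt ((mcnNeg isHalfRetraction_tau10.toMcN).1 (clampPt (1 / 4)))) = _ at h'
    rw [e] at h'
    change 1 - tau10 (clampPt (3 / 4)).1 0 = 3 / 4 at h'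
    rw [tau10_eq, clampPt_apply (by norm_num) (by norm_num)] at h'
    norm_num at h'
  · rintro rfl
    exact isHalfRetraction_tau10.isMcNRetraction

lemma mcnComp_ne_mcnComp_mcnNeg_sigma10 :
    (fun f => mcnComp f isHalfRetraction_sigma10.toMcN) ≠
      fun f => mcnComp f (mcnNeg isHalfRetraction_sigma10.toMcN) := by
  intro h
  have h' := congrFun h mcnId
  simp only [mcnComp_id_left] at h'
  replace h' : sigma10 (clampPt 0).1 0 = 1 - sigma10 (clampPt 0).1 0 :=
    congrFun (congrArg Subtype.val h') (clampPt 0)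
  rw [sigma10_eq, clampPt_apply le_rfl zero_le_one] at h'
  norm_num at h'

/-- `σ` and `τ` are Z-retractions of `[0,1]` with range `[0,1/2]`; the
Z-homeomorphism domains of `σ` are exactly `[0,1/2]` and `[1/2,1]`, while `τ` has the
unique domain `[0,1/2]`; hence there are exactly two retractions of `McN([0,1])` onto
`A_σ` but exactly one onto `A_τ`, although `A_σ ≅ A_τ`. -/
theorem stmt10 :
    IsZRetraction sigma10 ∧ IsZRetraction tau10 ∧
    zRange sigma10 = seg 0 (1/2) ∧ zRange tau10 = seg 0 (1/2) ∧
    {Q : Set (Fin 1 → ℝ) | IsZHomeoDomain sigma10 Q} = {seg 0 (1/2), seg (1/2) 1} ∧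
    {Q : Set (Fin 1 → ℝ) | IsZHomeoDomain tau10 Q} = {seg 0 (1/2)} ∧
    Nat.card {ε : ↥(McN 1) → ↥(McN 1) // IsMcNRetraction ε (retAlg sigma10)} = 2 ∧
    Nat.card {ε : ↥(McN 1) → ↥(McN 1) // IsMcNRetraction ε (retAlg tau10)} = 1 ∧
    (∃ h : ↥(retAlg sigma10) → ↥(retAlg tau10),
      IsMVIsoFun (retAlg sigma10) (retAlg tau10) h) := by
  refine ⟨isHalfRetraction_sigma10.isZRetraction, isHalfRetraction_tau10.isZRetraction,
    isHalfRetraction_sigma10.zRange_eq, isHalfRetraction_tau10.zRange_eq, ?_, ?_, ?_, ?_,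
    isHalfRetraction_sigma10.exists_isMVIsoFun isHalfRetraction_tau10⟩
  · ext Q
    constructor
    · exact fun h =>
        (isHalfRetraction_sigma10.eq_seg_or_of_isZHomeoDomain h).imp_right And.left
    · rintro (rfl | rfl)
      exacts [isHalfRetraction_sigma10.isZHomeoDomain_seg, isZHomeoDomain_sigma10_seg]
  · ext Q
    refine ⟨fun h => (isHalfRetraction_tau10.eq_seg_or_of_isZHomeoDomain h).resolve_right ?_, ?_⟩
    · rintro ⟨-, h⟩
      have := congrFun (h (1 / 4) (by norm_num)) 0
      rw [tau10_eq] at this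
      norm_num at this
    · rintro rfl
      exact isHalfRetraction_tau10.isZHomeoDomain_seg
  · rw [← Set.coe_ofPred, Nat.card_coe_set_eq, setOf_isMcNRetraction_sigma10,
      Set.ncard_pair mcnComp_ne_mcnComp_mcnNeg_sigma10]
  · rw [← Set.coe_ofPred, Nat.card_coe_set_eq, setOf_isMcNRetraction_tau10, Set.ncard_singleton]
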